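/- Let b ≥ 2 be an integer, let j be an integer with 1 ≤ j ≤ b−1, and let n ≥ 1 be an integer with m = ⌊log_b n⌋. Then ∑_{k=0}^{m} {(n + j·b^k) / b^{k+1}} = (1/(b−1))·(s_b(n) − n/b^{m+1}) + (m+1)·j/b − λ'_{b−j}(n). -/

import Mathlib

/-- The sum of the `b`-ary digits of `n`. -/
def digitSum (b n : ℕ) : ℕ := (Nat.digits b n).sum

/-- `conjPart b n i` is `λ'_i(n)`: the number of `b`-ary digits of `n` that are `≥ i`. -/
def conjPart (b n i : ℕ) : ℕ := ((Nat.digits b n).filter (fun c => i ≤ c)).length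

theorem Nat.digits_eq_map_range {b n : ℕ} (hb : 2 ≤ b) (hn : n ≠ 0) :
    Nat.digits b n = (List.range (Nat.log b n + 1)).map fun k => n / b ^ k % b := by
  refine List.ext_getElem (by simp [Nat.length_digits b n (by omega) hn]) fun i h _ => ?_
  rw [← List.getD_eq_getElem _ 0 h, Nat.getD_digits n i hb]
  simp

theorem digitSum_eq_sum {b n : ℕ} (hb : 2 ≤ b) (hn : n ≠ 0) :
    digitSum b n = ∑ k ∈ Finset.range (Nat.log b n + 1), n / b ^ k % b := by
  rw [digitSum, Nat.digits_eq_map_range hb hn]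
  rfl

theorem List.length_filter_eq_sum_map {α : Type*} (p : α → Prop) [DecidablePred p] (l : List α) :
    (l.filter fun a => p a).length = (l.map fun a => if p a then 1 else 0).sum := by
  induction l with
  | nil => rfl
  | cons a l ih => by_cases h : p a <;> simp [h, ih, add_comm]

theorem conjPart_eq_sum {b n : ℕ} (i : ℕ) (hb : 2 ≤ b) (hn : n ≠ 0) :
    conjPart b n i =
      ∑ k ∈ Finset.range (Nat.log b n + 1), if i ≤ n / b ^ k % b then 1 else 0 := by
  rw [conjPart, Nat.digits_eq_map_range hb hn, List.length_filter_eq_sum_map, List.map_map]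
  rfl

/-- Adding `j / b` to the fractional part of `n / b ^ (k + 1)` carries exactly when the `k`-th digit
of `n` is at least `b - j`. -/
theorem fract_add_mul_pow_div {b j : ℕ} (n k : ℕ) (hj : j < b) :
    Int.fract (((n : ℚ) + j * b ^ k) / b ^ (k + 1)) =
      ((n % b ^ (k + 1) : ℕ) : ℚ) / b ^ (k + 1) + j / b
        - if b - j ≤ n / b ^ k % b then 1 else 0 := by
  have hb : 0 < b := by omega
  have hbk : 0 < b ^ k := by positivity
  have hdiv : n = b ^ (k + 1) * (n / b ^ (k + 1)) + n % b ^ (k + 1) :=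
    (Nat.div_add_mod _ _).symm
  have hmod : n % b ^ (k + 1) = n % b ^ k + b ^ k * (n / b ^ k % b) := by
    rw [pow_succ, Nat.mod_mul]
  have hr : n % b ^ k < b ^ k := Nat.mod_lt _ hbk
  have hc : n / b ^ k % b < b := Nat.mod_lt _ hb
  have hbQ : (0 : ℚ) < b := by exact_mod_cast hb
  have hP : (0 : ℚ) < (b : ℚ) ^ (k + 1) := by positivity
  have hdivQ : (n : ℚ) = b ^ (k + 1) * ((n / b ^ (k + 1) : ℕ) : ℚ) + (n % b ^ (k + 1) : ℕ) := by
    exact_mod_cast hdiv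
  have hj' : (j : ℚ) / b = j * b ^ k / b ^ (k + 1) := by
    field_simp
    ring
  rw [hj', Int.fract_eq_iff]
  generalize n / b ^ (k + 1) = q at *
  generalize n % b ^ (k + 1) = M at *
  generalize n / b ^ k % b = c at *
  generalize n % b ^ k = r at *
  split_ifs with h
  · have h1 : b ^ (k + 1) ≤ M + j * b ^ k := by
      rw [pow_succ]
      nlinarith [Nat.mul_le_mul_left (b ^ k) (show b ≤ c + j by omega)]
    have h2 : M + j * b ^ k < 2 * b ^ (k + 1) := by
      rw [pow_succ]
      nlinarith [Nat.mul_le_mul_left (b ^ k) (show c + j + 1 ≤ 2 * b by omega)]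
    have h1Q : (b : ℚ) ^ (k + 1) ≤ M + j * b ^ k := by exact_mod_cast h1
    have h2Q : (M : ℚ) + j * b ^ k < 2 * b ^ (k + 1) := by exact_mod_cast h2
    rw [← add_div]
    refine ⟨?_, ?_, q + 1, ?_⟩
    · rw [sub_nonneg, one_le_div hP]; exact h1Q
    · rw [sub_lt_iff_lt_add, div_lt_iff₀ hP]; linarith
    · rw [hdivQ]; push_cast; field_simp; ring
  · have h2 : M + j * b ^ k < b ^ (k + 1) := by
      rw [pow_succ]
      nlinarith [Nat.mul_le_mul_left (b ^ k) (show c + j + 1 ≤ b by omega)]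
    have h2Q : (M : ℚ) + j * b ^ k < b ^ (k + 1) := by exact_mod_cast h2
    rw [← add_div, sub_zero]
    refine ⟨by positivity, ?_, q, ?_⟩
    · rw [div_lt_one hP]; exact h2Q
    · rw [hdivQ]; push_cast; field_simp; ring

theorem sub_one_mul_sum_mod_pow_div {b : ℕ} (n N : ℕ) (hb : 0 < b) :
    ((b : ℚ) - 1) * ∑ k ∈ Finset.range N, ((n % b ^ (k + 1) : ℕ) : ℚ) / b ^ (k + 1) =
      ((∑ k ∈ Finset.range N, n / b ^ k % b : ℕ) : ℚ) - ((n % b ^ N : ℕ) : ℚ) / b ^ N := by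
  have hbQ : (b : ℚ) ≠ 0 := by exact_mod_cast hb.ne'
  induction N with
  | zero => simp [Nat.mod_one]
  | succ N ih =>
    have hmod : n % b ^ (N + 1) = n % b ^ N + b ^ N * (n / b ^ N % b) := by
      rw [pow_succ, Nat.mod_mul]
    rw [Finset.sum_range_succ, Finset.sum_range_succ, mul_add, ih, hmod]
    push_cast
    field_simp
    ring

/-- For a base `b ≥ 2`, an integer `1 ≤ j ≤ b-1` and an integer `n ≥ 1` with
`m = ⌊log_b n⌋`, we have
`∑_{k=0}^{m} {(n + j·b^k)/b^(k+1)}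
  = (1/(b−1))·(s_b(n) − n/b^(m+1)) + (m+1)·j/b − λ'_{b−j}(n)`. -/
theorem fract_single_sum (b j n : ℕ) (hb : 2 ≤ b) (hj1 : 1 ≤ j) (hj2 : j ≤ b - 1)
    (hn : 1 ≤ n) :
    ∑ k ∈ Finset.range (Nat.log b n + 1), Int.fract (((n : ℚ) + j * b ^ k) / b ^ (k + 1)) =
      (1 / ((b : ℚ) - 1)) * ((digitSum b n : ℚ) - (n : ℚ) / b ^ (Nat.log b n + 1))
        + ((Nat.log b n : ℚ) + 1) * j / b - conjPart b n (b - j) := by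
  have hn0 : n ≠ 0 := by omega
  have hb1 : (b : ℚ) - 1 ≠ 0 := by
    have : (2 : ℚ) ≤ b := by exact_mod_cast hb
    linarith
  have h := sub_one_mul_sum_mod_pow_div n (Nat.log b n + 1) (show 0 < b by omega)
  rw [Nat.mod_eq_of_lt (Nat.lt_pow_succ_log_self (by omega) n), ← digitSum_eq_sum hb hn0] at h
  rw [← h, one_div, inv_mul_cancel_left₀ hb1, conjPart_eq_sum _ hb hn0,
    Finset.sum_congr rfl fun k _ => fract_add_mul_pow_div n k (show j < b by omega),
    Finset.sum_sub_distrib, Finset.sum_add_distrib]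
  simp
  ring
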